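/- arXiv:2207.02609 — 5 statements merged into one kernel-verified Lean document; each statement's English description precedes it below -/
import Mathlib

section
/- Let γ ≥ 1, let (X = C ⊔ F, d, w) be a γ-colorful space whose color functions w_1, …, w_γ have pairwise disjoint supports, and let r, L ≥ 0. Write C_{<γ} = C ∖ supp(w_γ). If the (γ−1)-colorful space (C_{<γ} ⊔ F, d, (w_1,…,w_{γ−1})) admits an (L,r)-partition, then the γ-colorful space (X, d, w) admits a (2L+10, r)-partition. -/
open Finset

attribute [local instance] Classical.propDecidable

/-- `B_U(V,s)`: the elements of `U` within distance `s` of some point of `V`. -/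
noncomputable def ballIn {X : Type*} [MetricSpace X] [Fintype X]
    (U V : Finset X) (s : ℝ) : Finset X :=
  U.filter fun u => ∃ v ∈ V, dist v u ≤ s

/-- `Ps` is a partition of the client set `C`. -/
def IsPartitionOf {X : Type*} (Ps : Finset (Finset X)) (C : Finset X) : Prop :=
  (∀ A ∈ Ps, A ⊆ C) ∧ (∀ c ∈ C, ∃ A ∈ Ps, c ∈ A) ∧
    (∀ A ∈ Ps, ∀ B ∈ Ps, A ≠ B → Disjoint A B)

/-- `Ps` is an `(L,r)`-partition of the `γ`-colorful space with clients `C`,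
facilities `F` and color functions `w`. -/
def IsLrPartition {X : Type*} [MetricSpace X] [Fintype X]
    (C F : Finset X) (γ : ℕ) (w : Fin γ → X → ℝ) (L r : ℝ)
    (Ps : Finset (Finset X)) : Prop :=
  IsPartitionOf Ps C ∧
    (∀ A ∈ Ps, ∀ u ∈ A, ∀ v ∈ A, dist u v ≤ L * r) ∧
    (∀ Z ⊆ F, ∃ As ⊆ Ps, ∃ h : Finset X → X,
      Set.InjOn h ↑As ∧ (∀ A ∈ As, h A ∈ Z) ∧
      (∀ A ∈ As, ∃ a ∈ A, dist a (h A) ≤ r) ∧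
      (∀ ℓ : Fin γ, ∑ c ∈ As.biUnion id, w ℓ c ≥ ∑ c ∈ ballIn C Z r, w ℓ c))

lemma mem_ballIn {X : Type*} [MetricSpace X] [Fintype X] {U V : Finset X} {s : ℝ} {u : X} :
    u ∈ ballIn U V s ↔ u ∈ U ∧ ∃ v ∈ V, dist v u ≤ s := by
  simp [ballIn]

lemma ballIn_subset {X : Type*} [MetricSpace X] [Fintype X] (U V : Finset X) (s : ℝ) :
    ballIn U V s ⊆ U :=
  Finset.filter_subset _ _

lemma Finset.sum_le_sum_of_subset_of_forall_nonneg {X : Type*} {v : X → ℝ} (hv : ∀ x, 0 ≤ v x)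
    {S T : Finset X} (h : S ⊆ T) : ∑ c ∈ S, v c ≤ ∑ c ∈ T, v c :=
  Finset.sum_le_sum_of_subset_of_nonneg h fun x _ _ => hv x

lemma Finset.sum_union_le_add {X : Type*} {v : X → ℝ} (hv : ∀ x, 0 ≤ v x)
    (S T : Finset X) : ∑ c ∈ S ∪ T, v c ≤ ∑ c ∈ S, v c + ∑ c ∈ T, v c := by
  rw [← Finset.sum_union_inter]
  linarith [Finset.sum_nonneg fun x (_ : x ∈ S ∩ T) => hv x]

/-- `h` matches the clusters in `As` injectively to points of `Z` at distance at most `r`. -/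
def IsMatchedTo {X : Type*} [MetricSpace X] (As : Finset (Finset X)) (h : Finset X → X)
    (Z : Finset X) (r : ℝ) : Prop :=
  Set.InjOn h ↑As ∧ (∀ A ∈ As, h A ∈ Z) ∧ ∀ A ∈ As, ∃ a ∈ A, dist a (h A) ≤ r

lemma IsMatchedTo.subset {X : Type*} [MetricSpace X] {As Bs : Finset (Finset X)}
    {h : Finset X → X} {Z Z' : Finset X} {r : ℝ} (H : IsMatchedTo As h Z r) (hB : Bs ⊆ As)
    (hZ : ∀ A ∈ Bs, h A ∈ Z') : IsMatchedTo Bs h Z' r :=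
  ⟨H.1.mono (by exact_mod_cast hB), hZ, fun A hA => H.2.2 A (hB hA)⟩

lemma IsMatchedTo.insert_update {X : Type*} [MetricSpace X] {Bs : Finset (Finset X)}
    {h : Finset X → X} {Z : Finset X} {r : ℝ} {z : X} {G : Finset X} (hz : z ∈ Z) (hG : G ∉ Bs)
    (hGz : ∃ g ∈ G, dist g z ≤ r) (H : IsMatchedTo Bs h (Z.erase z) r) :
    IsMatchedTo (insert G Bs) (Function.update h G z) Z r := by
  obtain ⟨hinj, hmem, hdist⟩ := H
  have hne : ∀ B ∈ Bs, B ≠ G := fun B hB e => hG (e ▸ hB)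
  refine ⟨?_, ?_, ?_⟩
  · intro A hA B hB e
    simp only [Finset.coe_insert, Set.mem_insert_iff, Finset.mem_coe] at hA hB
    rcases hA with rfl | hA <;> rcases hB with rfl | hB
    · rfl
    · rw [Function.update_self, Function.update_of_ne (hne B hB)] at e
      exact absurd e.symm (Finset.ne_of_mem_erase (hmem B hB))
    · rw [Function.update_self, Function.update_of_ne (hne A hA)] at e
      exact absurd e (Finset.ne_of_mem_erase (hmem A hA))
    · rw [Function.update_of_ne (hne A hA), Function.update_of_ne (hne B hB)] at e
      exact hinj hA hB e
  · intro A hA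
    rcases Finset.mem_insert.1 hA with rfl | hA
    · simpa using hz
    · rw [Function.update_of_ne (hne A hA)]
      exact Finset.mem_of_mem_erase (hmem A hA)
  · intro A hA
    rcases Finset.mem_insert.1 hA with rfl | hA
    · simpa using hGz
    · rw [Function.update_of_ne (hne A hA)]
      exact hdist A hA

/-- The clusters of `Ps` within distance `2r` of the set `R`. -/
noncomputable def attached {X : Type*} [MetricSpace X] (Ps : Finset (Finset X)) (R : Finset X)
    (r : ℝ) : Finset (Finset X) :=
  Ps.filter fun A => ∃ a ∈ A, ∃ p ∈ R, dist a p ≤ 2 * r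

lemma dist_le_of_mem_union_attached {X : Type*} [MetricSpace X] {Ps : Finset (Finset X)}
    {R : Finset X} {r D : ℝ} (hr : 0 ≤ r) (hD : 0 ≤ D)
    (hPs : ∀ A ∈ Ps, ∀ u ∈ A, ∀ v ∈ A, dist u v ≤ D)
    (hR : ∀ u ∈ R, ∀ v ∈ R, dist u v ≤ 6 * r) {u v : X}
    (hu : u ∈ R ∪ (attached Ps R r).biUnion id) (hv : v ∈ R ∪ (attached Ps R r).biUnion id) :
    dist u v ≤ 2 * D + 10 * r := by
  have key : ∀ x ∈ R ∪ (attached Ps R r).biUnion id, ∃ p ∈ R, dist x p ≤ D + 2 * r := by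
    intro x hx
    rcases Finset.mem_union.1 hx with hx | hx
    · exact ⟨x, hx, by rw [dist_self]; positivity⟩
    · obtain ⟨A, hA, hxA⟩ := Finset.mem_biUnion.1 hx
      obtain ⟨hAP, a, ha, p, hp, hap⟩ := Finset.mem_filter.1 hA
      exact ⟨p, hp, by linarith [dist_triangle x a p, hPs A hAP x hxA a ha]⟩
  obtain ⟨p, hp, hup⟩ := key u hu
  obtain ⟨q, hq, hvq⟩ := key v hv
  linarith [dist_triangle4 u p q v, dist_comm v q, hR p hp q hq]

/-- One step of the greedy charging argument: if a heaviest ball around `f` is enlarged and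
removed from `U`, then either the removed cluster is irrelevant for `Z`, or some `z ∈ Z` can be
matched to it so that its weight pays for the part of the demand that disappears. -/
lemma exists_match_or_irrelevant {X : Type*} [MetricSpace X] [Fintype X] {v : X → ℝ}
    (hv : ∀ x, 0 ≤ v x) {U Z : Finset X} {Ps As : Finset (Finset X)} {h : Finset X → X}
    {f : X} {r : ℝ} (hr : 0 ≤ r)
    (hf : ∀ z ∈ Z, ∑ c ∈ ballIn U {z} r, v c ≤ ∑ c ∈ ballIn U {f} r, v c)
    (hAs : As ⊆ Ps) (H : IsMatchedTo As h Z r) :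
    let R := ballIn U {f} (3 * r)
    (∃ z ∈ Z, (∃ g ∈ R ∪ (attached Ps R r).biUnion id, dist g z ≤ r) ∧
      (∀ A ∈ As \ attached Ps R r, h A ≠ z) ∧
      ∑ c ∈ ballIn U Z r, v c ≤ ∑ c ∈ R, v c + ∑ c ∈ ballIn (U \ R) (Z.erase z) r, v c) ∨
    (As ⊆ Ps \ attached Ps R r ∧ ballIn U Z r = ballIn (U \ R) Z r) := by
  intro R
  have hcore : ballIn U {f} r ⊆ R := by
    intro u hu
    simp only [R, mem_ballIn, Finset.mem_singleton, exists_eq_left] at hu ⊢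
    exact ⟨hu.1, by linarith⟩
  have hnear : ∀ z, (∃ p ∈ R, dist z p ≤ r) → ∀ A ∈ As \ attached Ps R r, h A ≠ z := by
    rintro z ⟨p, hp, hzp⟩ A hA rfl
    obtain ⟨hA, hA'⟩ := Finset.mem_sdiff.1 hA
    obtain ⟨a, ha, haz⟩ := H.2.2 A hA
    exact hA' (Finset.mem_filter.2 ⟨hAs hA, a, ha, p, hp, by
      linarith [dist_triangle a (h A) p]⟩)
  by_cases h1 : ∃ z ∈ Z, ∃ p ∈ ballIn U {f} r, dist z p ≤ r
  · obtain ⟨z, hz, p, hp, hzp⟩ := h1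
    refine Or.inl ⟨z, hz, ⟨p, Finset.mem_union_left _ (hcore hp), by rwa [dist_comm]⟩,
      hnear z ⟨p, hcore hp, hzp⟩, ?_⟩
    refine (Finset.sum_le_sum_of_subset_of_forall_nonneg hv ?_).trans
      (Finset.sum_union_le_add hv _ _)
    intro u hu
    obtain ⟨huU, y, hy, hyu⟩ := mem_ballIn.1 hu
    by_cases huR : u ∈ R
    · exact Finset.mem_union_left _ huR
    refine Finset.mem_union_right _ (mem_ballIn.2 ⟨Finset.mem_sdiff.2 ⟨huU, huR⟩, y,
      Finset.mem_erase.2 ⟨?_, hy⟩, hyu⟩)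
    rintro rfl
    simp only [R, mem_ballIn, Finset.mem_singleton, exists_eq_left] at hp huR
    exact huR ⟨huU, by linarith [dist_triangle4 f p y u, dist_comm p y]⟩
  · have hpay : ∀ z ∈ Z, ∑ c ∈ ballIn U Z r, v c ≤
        ∑ c ∈ R, v c + ∑ c ∈ ballIn (U \ R) (Z.erase z) r, v c := by
      intro z hz
      have hsub : ballIn U Z r ⊆
          (R \ ballIn U {f} r ∪ ballIn U {z} r) ∪ ballIn (U \ R) (Z.erase z) r := by
        intro u hu
        obtain ⟨huU, y, hy, hyu⟩ := mem_ballIn.1 hu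
        have hucore : u ∉ ballIn U {f} r := fun hc => h1 ⟨y, hy, u, hc, hyu⟩
        by_cases huR : u ∈ R
        · exact Finset.mem_union_left _ (Finset.mem_union_left _
            (Finset.mem_sdiff.2 ⟨huR, hucore⟩))
        by_cases hyz : y = z
        · exact Finset.mem_union_left _ (Finset.mem_union_right _
            (mem_ballIn.2 ⟨huU, z, Finset.mem_singleton_self z, hyz ▸ hyu⟩))
        · exact Finset.mem_union_right _ (mem_ballIn.2 ⟨Finset.mem_sdiff.2 ⟨huU, huR⟩, y,
            Finset.mem_erase.2 ⟨hyz, hy⟩, hyu⟩)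
      have e1 := Finset.sum_le_sum_of_subset_of_forall_nonneg hv hsub
      have e2 := Finset.sum_union_le_add hv (R \ ballIn U {f} r ∪ ballIn U {z} r)
        (ballIn (U \ R) (Z.erase z) r)
      have e3 := Finset.sum_union_le_add hv (R \ ballIn U {f} r) (ballIn U {z} r)
      have e4 := Finset.sum_sdiff (f := v) hcore
      linarith [hf z hz]
    by_cases h2 : ∃ z ∈ Z, ∃ p ∈ R, dist z p ≤ r
    · obtain ⟨z, hz, p, hp, hzp⟩ := h2
      exact Or.inl ⟨z, hz, ⟨p, Finset.mem_union_left _ hp, by rwa [dist_comm]⟩,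
        hnear z ⟨p, hp, hzp⟩, hpay z hz⟩
    by_cases h3 : ∃ A ∈ As, A ∈ attached Ps R r
    · obtain ⟨A, hA, hAt⟩ := h3
      obtain ⟨a, ha, haz⟩ := H.2.2 A hA
      refine Or.inl ⟨h A, H.2.1 A hA, ⟨a, Finset.mem_union_right _
        (Finset.mem_biUnion.2 ⟨A, hAt, ha⟩), haz⟩, ?_, hpay _ (H.2.1 A hA)⟩
      intro B hB e
      obtain ⟨hB, hB'⟩ := Finset.mem_sdiff.1 hB
      exact hB' (H.1 hB hA e ▸ hAt)
    · refine Or.inr ⟨fun A hA => Finset.mem_sdiff.2 ⟨hAs hA, fun hc => h3 ⟨A, hA, hc⟩⟩, ?_⟩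
      ext u
      simp only [mem_ballIn, Finset.mem_sdiff]
      refine ⟨?_, fun hu => ⟨hu.1.1, hu.2⟩⟩
      rintro ⟨huU, y, hy, hyu⟩
      exact ⟨⟨huU, fun hc => h2 ⟨y, hy, u, hc, hyu⟩⟩, y, hy, hyu⟩

/-- A family of disjoint clusters of diameter at most `D` can be merged with an additional weighted
set `U` of clients into clusters of diameter at most `2D + 10r`, such that every matched
subfamily of old clusters is contained in a matched subfamily of new clusters which moreover has
at least the weight of the part of `U` served. -/
lemma exists_merged_partition {X : Type*} [MetricSpace X] [Fintype X] (F : Finset X) (v : X → ℝ)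
    (hv : ∀ x, 0 ≤ v x) {r D : ℝ} (hr : 0 ≤ r) (hD : 0 ≤ D) (U : Finset X)
    (Ps : Finset (Finset X)) (hPsU : Disjoint U (Ps.biUnion id))
    (hPs : ∀ A ∈ Ps, ∀ B ∈ Ps, A ≠ B → Disjoint A B)
    (hdiam : ∀ A ∈ Ps, ∀ u ∈ A, ∀ v ∈ A, dist u v ≤ D) :
    ∃ Qs : Finset (Finset X), IsPartitionOf Qs (U ∪ Ps.biUnion id) ∧
      (∀ A ∈ Qs, ∀ u ∈ A, ∀ v ∈ A, dist u v ≤ 2 * D + 10 * r) ∧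
      ∀ Z ⊆ F, ∀ As ⊆ Ps, ∀ h : Finset X → X, IsMatchedTo As h Z r →
        ∃ Bs ⊆ Qs, ∃ h' : Finset X → X, IsMatchedTo Bs h' Z r ∧
          As.biUnion id ⊆ Bs.biUnion id ∧
          ∑ c ∈ ballIn U Z r, v c ≤ ∑ c ∈ Bs.biUnion id, v c := by
  induction U using Finset.strongInduction generalizing Ps with
  | H U ih =>
  rw [Finset.disjoint_biUnion_right] at hPsU
  simp only [id] at hPsU
  by_cases hF : (F.filter fun f => (ballIn U {f} r).Nonempty).Nonempty
  · obtain ⟨f, hfF, hfmax⟩ := Finset.exists_max_image _ (fun f => ∑ c ∈ ballIn U {f} r, v c) hF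
    obtain ⟨-, hfne⟩ := Finset.mem_filter.1 hfF
    have hf : ∀ z ∈ F, ∑ c ∈ ballIn U {z} r, v c ≤ ∑ c ∈ ballIn U {f} r, v c := by
      intro z hz
      by_cases hzne : (ballIn U {z} r).Nonempty
      · exact hfmax z (Finset.mem_filter.2 ⟨hz, hzne⟩)
      · rw [Finset.not_nonempty_iff_eq_empty.1 hzne, Finset.sum_empty]
        exact Finset.sum_nonneg fun x _ => hv x
    set R := ballIn U {f} (3 * r)
    have hRU : R ⊆ U := ballIn_subset _ _ _
    have hRne : R.Nonempty := by
      obtain ⟨p, hp⟩ := hfne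
      refine ⟨p, ?_⟩
      simp only [R, mem_ballIn, Finset.mem_singleton, exists_eq_left] at hp ⊢
      exact ⟨hp.1, by linarith⟩
    have hRdiam : ∀ x ∈ R, ∀ y ∈ R, dist x y ≤ 6 * r := by
      intro x hx y hy
      simp only [R, mem_ballIn, Finset.mem_singleton, exists_eq_left] at hx hy
      linarith [dist_triangle x f y, dist_comm x f]
    set T := attached Ps R r
    have hTP : T ⊆ Ps := Finset.filter_subset _ _
    set G := R ∪ T.biUnion id
    have hGne : G.Nonempty := hRne.mono Finset.subset_union_left
    obtain ⟨Qs, ⟨hQsub, hQcov, hQdisj⟩, hQdiam, hQ⟩ := ih (U \ R)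
      (Finset.sdiff_ssubset hRU hRne) (Ps \ T)
      (by
        rw [Finset.disjoint_biUnion_right]
        intro A hA
        exact Disjoint.mono_left Finset.sdiff_subset (hPsU A (Finset.mem_sdiff.1 hA).1))
      (fun A hA B hB => hPs A (Finset.mem_sdiff.1 hA).1 B (Finset.mem_sdiff.1 hB).1)
      (fun A hA => hdiam A (Finset.mem_sdiff.1 hA).1)
    have hGrest : Disjoint G (U \ R ∪ (Ps \ T).biUnion id) := by
      simp only [G, Finset.disjoint_union_left, Finset.disjoint_union_right,
        Finset.disjoint_biUnion_left, Finset.disjoint_biUnion_right, id]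
      refine ⟨⟨Finset.disjoint_sdiff, fun A hA =>
        ((hPsU A (hTP hA)).mono_left Finset.sdiff_subset).symm⟩, fun B hB => ⟨?_, fun A hA => ?_⟩⟩
      · exact (hPsU B (Finset.mem_sdiff.1 hB).1).mono_left hRU
      · obtain ⟨hBP, hBT⟩ := Finset.mem_sdiff.1 hB
        exact hPs A (hTP hA) B hBP fun e => hBT (e ▸ hA)
    have hGQ : ∀ B ∈ Qs, Disjoint G B := fun B hB => hGrest.mono_right (hQsub B hB)
    have hGnot : G ∉ Qs := fun hG => hGne.ne_empty (disjoint_self.1 (hGQ G hG))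
    have hsplit : U ∪ Ps.biUnion id = G ∪ (U \ R ∪ (Ps \ T).biUnion id) := by
      conv_lhs => rw [← Finset.union_sdiff_of_subset hRU, ← Finset.union_sdiff_of_subset hTP,
        Finset.union_biUnion, Finset.union_union_union_comm]
    refine ⟨insert G Qs, ⟨?_, ?_, ?_⟩, ?_, ?_⟩
    · rw [hsplit]
      intro A hA
      rcases Finset.mem_insert.1 hA with rfl | hA
      · exact Finset.subset_union_left
      · exact (hQsub A hA).trans Finset.subset_union_right
    · rw [hsplit]
      intro c hc
      rcases Finset.mem_union.1 hc with hc | hc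
      · exact ⟨G, Finset.mem_insert_self _ _, hc⟩
      · obtain ⟨A, hA, hcA⟩ := hQcov c hc
        exact ⟨A, Finset.mem_insert_of_mem hA, hcA⟩
    · intro A hA B hB hAB
      rcases Finset.mem_insert.1 hA with rfl | hA <;> rcases Finset.mem_insert.1 hB with rfl | hB
      · exact absurd rfl hAB
      · exact hGQ B hB
      · exact (hGQ A hA).symm
      · exact hQdisj A hA B hB hAB
    · intro A hA
      rcases Finset.mem_insert.1 hA with rfl | hA
      · intro x hx y hy
        exact dist_le_of_mem_union_attached hr hD hdiam hRdiam hx hy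
      · exact hQdiam A hA
    · intro Z hZ As hAs h H
      rcases exists_match_or_irrelevant hv hr (fun z hz => hf z (hZ hz)) hAs H with
        ⟨z, hz, hGz, hAz, hpay⟩ | ⟨hAsub, hball⟩
      · obtain ⟨Bs, hBs, h', H', hcov, hsum⟩ := hQ (Z.erase z)
          ((Finset.erase_subset _ _).trans hZ) (As \ T) (Finset.sdiff_subset_sdiff hAs subset_rfl)
          h (H.subset Finset.sdiff_subset fun A hA =>
            Finset.mem_erase.2 ⟨hAz A hA, H.2.1 A (Finset.mem_sdiff.1 hA).1⟩)
        refine ⟨insert G Bs, Finset.insert_subset_insert _ hBs, Function.update h' G z,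
          H'.insert_update hz (fun hG => hGnot (hBs hG)) hGz, ?_, ?_⟩
        · rw [Finset.biUnion_insert, Finset.biUnion_subset]
          intro A hA
          by_cases hAT : A ∈ T
          · exact (Finset.subset_biUnion_of_mem id hAT).trans
              (Finset.subset_union_right.trans Finset.subset_union_left)
          · exact (Finset.subset_biUnion_of_mem id (Finset.mem_sdiff.2 ⟨hA, hAT⟩)).trans
              (hcov.trans Finset.subset_union_right)
        · rw [Finset.biUnion_insert, id, Finset.sum_union (s₂ := Bs.biUnion id)
            ((Finset.disjoint_biUnion_right _ _ _).2 fun B hB => hGQ B (hBs hB))]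
          have hRG : ∑ c ∈ R, v c ≤ ∑ c ∈ G, v c :=
            Finset.sum_le_sum_of_subset_of_forall_nonneg hv Finset.subset_union_left
          linarith
      · obtain ⟨Bs, hBs, h', H', hcov, hsum⟩ := hQ Z hZ As hAsub h H
        exact ⟨Bs, hBs.trans (Finset.subset_insert _ _), h', H', hcov, by rw [hball]; exact hsum⟩
  · have hdisj : ∀ A ∈ Ps, ∀ x ∈ U, x ∉ A := fun A hA x hx =>
      Finset.disjoint_left.1 (hPsU A hA) hx
    refine ⟨Ps ∪ U.image fun x => {x}, ⟨?_, ?_, ?_⟩, ?_, ?_⟩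
    · intro A hA
      rcases Finset.mem_union.1 hA with hA | hA
      · exact (Finset.subset_biUnion_of_mem id hA).trans Finset.subset_union_right
      · obtain ⟨x, hx, rfl⟩ := Finset.mem_image.1 hA
        exact Finset.singleton_subset_iff.2 (Finset.mem_union_left _ hx)
    · intro c hc
      rcases Finset.mem_union.1 hc with hc | hc
      · exact ⟨{c}, Finset.mem_union_right _ (Finset.mem_image_of_mem _ hc),
          Finset.mem_singleton_self c⟩
      · obtain ⟨A, hA, hcA⟩ := Finset.mem_biUnion.1 hc
        exact ⟨A, Finset.mem_union_left _ hA, hcA⟩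
    · intro A hA B hB hAB
      rcases Finset.mem_union.1 hA with hA | hA <;> rcases Finset.mem_union.1 hB with hB | hB
      · exact hPs A hA B hB hAB
      · obtain ⟨x, hx, rfl⟩ := Finset.mem_image.1 hB
        exact Finset.disjoint_singleton_right.2 (hdisj A hA x hx)
      · obtain ⟨x, hx, rfl⟩ := Finset.mem_image.1 hA
        exact Finset.disjoint_singleton_left.2 (hdisj B hB x hx)
      · obtain ⟨x, hx, rfl⟩ := Finset.mem_image.1 hA
        obtain ⟨y, hy, rfl⟩ := Finset.mem_image.1 hB
        exact Finset.disjoint_singleton.2 fun e => hAB (by rw [e])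
    · intro A hA x hx y hy
      rcases Finset.mem_union.1 hA with hA | hA
      · linarith [hdiam A hA x hx y hy]
      · obtain ⟨z, hz, rfl⟩ := Finset.mem_image.1 hA
        rw [Finset.mem_singleton.1 hx, Finset.mem_singleton.1 hy, dist_self]
        positivity
    · intro Z hZ As hAs h H
      refine ⟨As, hAs.trans Finset.subset_union_left, h, H, subset_rfl, ?_⟩
      have hempty : ballIn U Z r = ∅ := by
        refine Finset.eq_empty_of_forall_notMem fun u hu => hF ?_
        obtain ⟨huU, z, hz, hzu⟩ := mem_ballIn.1 hu
        exact ⟨z, Finset.mem_filter.2 ⟨hZ hz, u,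
          mem_ballIn.2 ⟨huU, z, Finset.mem_singleton_self z, hzu⟩⟩⟩
      rw [hempty, Finset.sum_empty]
      exact Finset.sum_nonneg fun x _ => hv x

lemma sum_ballIn_filter {X : Type*} [MetricSpace X] [Fintype X] (C Z : Finset X) (r : ℝ)
    {v : X → ℝ} {p : X → Prop} [DecidablePred p] (hp : ∀ x, ¬ p x → v x = 0) :
    ∑ c ∈ ballIn (C.filter p) Z r, v c = ∑ c ∈ ballIn C Z r, v c := by
  refine Finset.sum_subset (fun u hu => ?_) fun u hu hu' => hp u fun hpu => hu' ?_
  · obtain ⟨huC, hu⟩ := mem_ballIn.1 hu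
    exact mem_ballIn.2 ⟨(Finset.mem_filter.1 huC).1, hu⟩
  · obtain ⟨huC, hu⟩ := mem_ballIn.1 hu
    exact mem_ballIn.2 ⟨Finset.mem_filter.2 ⟨huC, hpu⟩, hu⟩

/-- (Induction step.) If, for a `(γ+1)`-colorful space with pairwise
disjoint color supports, the `γ`-colorful space obtained by removing the support of the
last color admits an `(L,r)`-partition, then the full space admits a `(2L+10, r)`-partition. -/
theorem Lr_partition_induction_step {X : Type*} [MetricSpace X] [Fintype X]
    (γ : ℕ) (C F : Finset X) (hdisj : Disjoint C F) (hcover : C ∪ F = Finset.univ)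
    (w : Fin (γ + 1) → X → ℝ) (hw : ∀ ℓ x, 0 ≤ w ℓ x)
    (hsupp : ∀ i j : Fin (γ + 1), i ≠ j → ∀ x : X, w i x = 0 ∨ w j x = 0)
    (r L : ℝ) (hr : 0 ≤ r) (hL : 0 ≤ L)
    (Ps : Finset (Finset X))
    (hprev : IsLrPartition (C.filter fun c => w (Fin.last γ) c = 0) F γ
      (fun i x => w i.castSucc x) L r Ps) :
    ∃ Ps' : Finset (Finset X),
      IsLrPartition C F (γ + 1) w (2 * L + 10) r Ps' := by
  obtain ⟨⟨hsub, hcov, hdisjPs⟩, hdiam, hmatch⟩ := hprev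
  have hunion : Ps.biUnion id = C.filter fun c => w (Fin.last γ) c = 0 := by
    refine (Finset.biUnion_subset.2 hsub).antisymm fun c hc => ?_
    obtain ⟨A, hA, hcA⟩ := hcov c hc
    exact Finset.mem_biUnion.2 ⟨A, hA, hcA⟩
  have hC : (C.filter fun c => ¬ w (Fin.last γ) c = 0) ∪ Ps.biUnion id = C := by
    rw [hunion, Finset.union_comm, Finset.filter_union_filter_not_eq]
  obtain ⟨Qs, hQpart, hQdiam, hQ⟩ := exists_merged_partition F (w (Fin.last γ)) (hw _) hr
    (mul_nonneg hL hr) (C.filter fun c => ¬ w (Fin.last γ) c = 0) Ps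
    (by rw [hunion]; exact (Finset.disjoint_filter_filter_not _ _ _).symm) hdisjPs hdiam
  rw [hC] at hQpart
  refine ⟨Qs, hQpart, fun A hA x hx y hy => ?_, fun Z hZ => ?_⟩
  · linarith [hQdiam A hA x hx y hy]
  obtain ⟨As, hAs, h, hinj, hmem, hdist, hsum⟩ := hmatch Z hZ
  obtain ⟨Bs, hBs, h', ⟨hinj', hmem', hdist'⟩, hABs, hlast⟩ :=
    hQ Z hZ As hAs h ⟨hinj, hmem, hdist⟩
  refine ⟨Bs, hBs, h', hinj', hmem', hdist', fun ℓ => ?_⟩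
  refine Fin.lastCases ?_ (fun i => ?_) ℓ
  · rwa [sum_ballIn_filter C Z r fun x hx => not_not.1 hx] at hlast
  · have hi := hsum i
    rw [sum_ballIn_filter C Z r fun x hx =>
      (hsupp i.castSucc (Fin.last γ) (Fin.castSucc_lt_last i).ne x).resolve_right hx] at hi
    exact hi.le.trans (Finset.sum_le_sum_of_subset_of_forall_nonneg (hw _) hABs)
end

section
/- Let (X = C ⊔ F, d) be a finite metric space with clients C and facilities F, r ≥ 0, γ ≥ 1, color functions w_ℓ : C → ℝ≥0 and thresholds τ_ℓ ≥ 0 for ℓ ∈ [γ], and a set E ⊆ F of expensive facilities. Let f ∈ F satisfy B_F(f, 4r) ⊆ E and w_{ℓ*}(B_C(f,r)) > 2τ_{ℓ*} for some ℓ* ∈ [γ]. Define Core(f) = {h ∈ F : w_ℓ̄(B_C(h,r) ∩ B_C(f,r)) > τ_ℓ̄ for some ℓ̄ ∈ [γ]} and Cluster(f) = B_C(Core(f), r). Let g ∈ F be a facility such that whenever g ∈ E, gain_ℓ(g, c) ≤ τ_ℓ for every client c ∈ B_C(g, r) and every ℓ ∈ [γ]. If B_C(g, r) ∩ Cluster(f)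 ≠ ∅, then g ∈ Core(f) (and hence B_C(g,r) ⊆ Cluster(f)). -/
open Finset

attribute [local instance] Classical.propDecidable

/-- The flower of a client `c`: the union of the radius-`r` client balls around the
facilities within distance `r` of `c`. -/
noncomputable def flower {X : Type*} [MetricSpace X] [Fintype X]
    (C F : Finset X) (r : ℝ) (c : X) : Finset X :=
  ballIn C (ballIn F {c} r) r

/-- `gain_ℓ(f,c) = w_ℓ(Flower(c) ∖ B_C(f,r))`. -/
noncomputable def gain {X : Type*} [MetricSpace X] [Fintype X]
    (C F : Finset X) (r : ℝ) (w : X → ℝ) (f c : X) : ℝ :=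
  ∑ x ∈ flower C F r c \ ballIn C {f} r, w x

/-- `Core(f) = {h ∈ F : w_ℓ̄(B_C(h,r) ∩ B_C(f,r)) > τ_ℓ̄ for some ℓ̄}`. -/
noncomputable def core {X : Type*} [MetricSpace X] [Fintype X]
    (C F : Finset X) (γ : ℕ) (w : Fin γ → X → ℝ) (τ : Fin γ → ℝ) (r : ℝ)
    (f : X) : Finset X :=
  F.filter fun h => ∃ ℓ : Fin γ, τ ℓ < ∑ x ∈ ballIn C {h} r ∩ ballIn C {f} r, w ℓ x

/-- `Cluster(f) = B_C(Core(f), r)`. -/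
noncomputable def cluster {X : Type*} [MetricSpace X] [Fintype X]
    (C F : Finset X) (γ : ℕ) (w : Fin γ → X → ℝ) (τ : Fin γ → ℝ) (r : ℝ)
    (f : X) : Finset X :=
  ballIn C (core C F γ w τ r f) r

theorem mem_ballIn_singleton {X : Type*} [MetricSpace X] [Fintype X]
    {U : Finset X} {v u : X} {s : ℝ} : u ∈ ballIn U {v} s ↔ u ∈ U ∧ dist v u ≤ s := by
  simp [ballIn]

/-- The client ball of a facility near `c` is a petal of the flower of `c`. -/
theorem ballIn_subset_flower {X : Type*} [MetricSpace X] [Fintype X]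
    {C F : Finset X} {r : ℝ} {c h : X} (hh : h ∈ F) (hc : dist h c ≤ r) :
    ballIn C {h} r ⊆ flower C F r c := by
  intro x hx
  obtain ⟨hxC, hx⟩ := mem_ballIn_singleton.1 hx
  exact mem_filter.2
    ⟨hxC, h, mem_ballIn_singleton.2 ⟨hh, by rwa [dist_comm]⟩, hx⟩

/-- A part of the flower of `c` outside the ball of `g` weighs at most the gain. -/
theorem sum_sdiff_ballIn_le_gain {X : Type*} [MetricSpace X] [Fintype X]
    {C F S : Finset X} {r : ℝ} {w : X → ℝ} (hw : ∀ x, 0 ≤ w x) {g c : X}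
    (hS : S ⊆ flower C F r c) :
    ∑ x ∈ S \ ballIn C {g} r, w x ≤ gain C F r w g c :=
  sum_le_sum_of_subset_of_nonneg (sdiff_subset_sdiff hS Subset.rfl) fun x _ _ => hw x

/-- Let `f` be a dense facility (all facilities within `4r` of `f` are
expensive and `w_{ℓ*}(B_C(f,r)) > 2τ_{ℓ*}` for some color `ℓ*`), and let `g` be a facility
whose gain is bounded by `τ` whenever `g` is expensive. If `B_C(g,r)` meets `Cluster(f)`,
then `g ∈ Core(f)`, and hence `B_C(g,r) ⊆ Cluster(f)`. -/
theorem dense_core_dichotomy {X : Type*} [MetricSpace X] [Fintype X]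
    (C F : Finset X) (hdisj : Disjoint C F) (hcover : C ∪ F = Finset.univ)
    (r : ℝ) (hr : 0 ≤ r) (γ : ℕ) (hγ : 1 ≤ γ)
    (w : Fin γ → X → ℝ) (hw : ∀ ℓ x, 0 ≤ w ℓ x)
    (τ : Fin γ → ℝ) (hτ : ∀ ℓ, 0 ≤ τ ℓ)
    (E : Finset X) (hE : E ⊆ F)
    (f : X) (hf : f ∈ F) (hfE : ballIn F {f} (4 * r) ⊆ E)
    (hfdense : ∃ ℓ : Fin γ, 2 * τ ℓ < ∑ c ∈ ballIn C {f} r, w ℓ c)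
    (g : X) (hg : g ∈ F)
    (hgain : g ∈ E → ∀ c ∈ ballIn C {g} r, ∀ ℓ, gain C F r (w ℓ) g c ≤ τ ℓ)
    (hmeet : (ballIn C {g} r ∩ cluster C F γ w τ r f).Nonempty) :
    g ∈ core C F γ w τ r f ∧ ballIn C {g} r ⊆ cluster C F γ w τ r f := by
  obtain ⟨c, hc⟩ := hmeet
  obtain ⟨hcg, hcc⟩ := mem_inter.1 hc
  obtain ⟨-, h, hhcore, hhc⟩ := mem_filter.1 hcc
  obtain ⟨hhF, k, hk⟩ := mem_filter.1 hhcore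
  have hgc := (mem_ballIn_singleton.1 hcg).2
  have hgE : g ∈ E := by
    obtain ⟨y, hy⟩ : (ballIn C {h} r ∩ ballIn C {f} r).Nonempty :=
      nonempty_of_sum_ne_zero ((hτ k).trans_lt hk).ne'
    obtain ⟨hyh, hyf⟩ := mem_inter.1 hy
    have hhy := (mem_ballIn_singleton.1 hyh).2
    have hfy := (mem_ballIn_singleton.1 hyf).2
    refine hfE (mem_ballIn_singleton.2 ⟨hg, ?_⟩)
    linarith [dist_triangle4 f y h c, dist_triangle f c g, dist_comm y h, dist_comm c g]
  obtain ⟨x, hxf, hxg⟩ : ∃ x ∈ ballIn C {f} r, x ∈ ballIn C {g} r := by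
    by_contra! hcon
    have hle := sum_sdiff_ballIn_le_gain (hw k) (g := g)
      ((inter_subset_left (s₂ := ballIn C {f} r)).trans
        (ballIn_subset_flower (C := C) hhF hhc))
    rw [sdiff_eq_self_of_disjoint
      (disjoint_left.2 fun x hx => hcon x (mem_inter.1 hx).2)] at hle
    linarith [hgain hgE c hcg k]
  have hgcore : g ∈ core C F γ w τ r f := by
    obtain ⟨l, hl⟩ := hfdense
    refine mem_filter.2 ⟨hg, l, ?_⟩
    have hle := sum_sdiff_ballIn_le_gain (hw l) (g := g)
      (ballIn_subset_flower (C := C) hf (mem_ballIn_singleton.1 hxf).2)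
    have hsplit := sum_inter_add_sum_sdiff (ballIn C {f} r) (ballIn C {g} r) (w l)
    rw [inter_comm]
    linarith [hgain hgE x hxg l]
  refine ⟨hgcore, fun y hy => ?_⟩
  obtain ⟨hyC, hgy⟩ := mem_ballIn_singleton.1 hy
  exact mem_filter.2 ⟨hyC, g, hgcore, hgy⟩
end

section
/- Let (X = C ⊔ F, d) be a finite metric space with clients C and facilities F, r ≥ 0, γ ≥ 1, color functions w_ℓ : C → ℝ≥0 and thresholds τ_ℓ ≥ 0 for ℓ ∈ [γ]. Let g ∈ F satisfy w_ℓ(B_C(g,r)) ≤ 2τ_ℓ for all ℓ ∈ [γ] and gain_ℓ(g, c') ≤ τ_ℓ for every client c' ∈ B_C(g,r) and every ℓ ∈ [γ]. If a client c ∈ C satisfies w_ℓ(Flower(c)) > 3τ_ℓ for some ℓ ∈ [γ], then d(g, c) > r. -/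
open Finset

attribute [local instance] Classical.propDecidable

/-- A non-dense facility `g` (i.e. `w_ℓ(B_C(g,r)) ≤ 2τ_ℓ` for all `ℓ`)
whose gain is bounded by `τ_ℓ` at every client of `B_C(g,r)` cannot be within distance `r`
of any client `c` whose flower is heavy, i.e. `w_ℓ(Flower(c)) > 3τ_ℓ` for some color `ℓ`. -/
theorem heavy_flower_far_from_sparse_facility {X : Type*} [MetricSpace X] [Fintype X]
    (C F : Finset X) (hdisj : Disjoint C F) (hcover : C ∪ F = Finset.univ)
    (r : ℝ) (hr : 0 ≤ r) (γ : ℕ) (hγ : 1 ≤ γ)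
    (w : Fin γ → X → ℝ) (hw : ∀ ℓ x, 0 ≤ w ℓ x)
    (τ : Fin γ → ℝ) (hτ : ∀ ℓ, 0 ≤ τ ℓ)
    (g : X) (hg : g ∈ F)
    (hnd : ∀ ℓ, ∑ x ∈ ballIn C {g} r, w ℓ x ≤ 2 * τ ℓ)
    (hgain : ∀ c' ∈ ballIn C {g} r, ∀ ℓ, gain C F r (w ℓ) g c' ≤ τ ℓ)
    (c : X) (hc : c ∈ C)
    (hheavy : ∃ ℓ : Fin γ, 3 * τ ℓ < ∑ x ∈ flower C F r c, w ℓ x) :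
    r < dist g c := by
  by_contra! hgc
  obtain ⟨ℓ, hℓ⟩ := hheavy
  have hcg : c ∈ ballIn C {g} r := by simp [ballIn, hc, hgc]
  have hgain_c := hgain c hcg ℓ
  have hball := hnd ℓ
  have hinter : ∑ x ∈ flower C F r c ∩ ballIn C {g} r, w ℓ x ≤ ∑ x ∈ ballIn C {g} r, w ℓ x :=
    Finset.sum_le_sum_of_subset_of_nonneg Finset.inter_subset_right fun x _ _ => hw ℓ x
  have hsplit := Finset.sum_inter_add_sum_sdiff (flower C F r c) (ballIn C {g} r) (w ℓ)
  unfold gain at hgain_c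
  linarith
end

section
/- Let (X = C ⊔ F, d) be a finite metric space with clients C and facilities F, r ≥ 0, γ ≥ 1, κ : F → ℝ≥0, K ≥ 0, color functions w_ℓ : C → ℝ≥0 and requirements m_ℓ ≥ 0 for ℓ ∈ [γ]. Let x : C → [0,1] and y : F → [0,1] satisfy ∑_{f∈F} κ(f) y(f) ≤ K, x(c) ≤ y(B_F(c,r)) for all c ∈ C, and ∑_{c∈C} w_ℓ(c) x(c) ≥ m_ℓ for all ℓ ∈ [γ]. Let Q ⊆ C be such that B_F(c,r) ≠ ∅ for all c ∈ Q and the sets B_F(c,r), c ∈ Q, are pairwise disjoint; let {D_c}_{c∈Q} be pairwise disjoint subsets of C with {b ∈ C : x(b) > 0} ⊆ ⋃_{c∈Q} D_c; and let z : Q → [0,1] satisfy x(b) ≤ z(c) for every b ∈ D_c and z(c) ≤ y(B_F(c,r)) for every c ∈ Q. Define η(c) = min_{f ∈ B_F(c,r)} κ(f). Then ∑_{c∈Q} w_ℓ(D_c) z(c) ≥ m_ℓ for all ℓ ∈ [γ] and ∑_{c∈Q} η(c) z(c) ≤ K. -/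
open Finset

attribute [local instance] Classical.propDecidable

/-- `η(c) = min_{f ∈ B_F(c,r)} κ(f)`. -/
noncomputable def cheapestNearby {X : Type*} [MetricSpace X] [Fintype X]
    (F : Finset X) (κ : X → ℝ) (r : ℝ) (c : X) : ℝ :=
  sInf ((((ballIn F {c} r).image κ) : Finset ℝ) : Set ℝ)

theorem mem_of_mem_ballIn {X : Type*} [MetricSpace X] [Fintype X]
    {U V : Finset X} {s : ℝ} {u : X} (h : u ∈ ballIn U V s) : u ∈ U :=
  (Finset.mem_filter.mp h).1

theorem cheapestNearby_le {X : Type*} [MetricSpace X] [Fintype X]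
    {F : Finset X} (κ : X → ℝ) {r : ℝ} {c f : X} (hf : f ∈ ballIn F {c} r) :
    cheapestNearby F κ r c ≤ κ f :=
  csInf_le (Finset.bddBelow _) (Finset.mem_coe.mpr (Finset.mem_image_of_mem κ hf))

theorem cheapestNearby_nonneg {X : Type*} [MetricSpace X] [Fintype X]
    (F : Finset X) {κ : X → ℝ} (hκ : ∀ f, 0 ≤ κ f) (r : ℝ) (c : X) :
    0 ≤ cheapestNearby F κ r c := by
  refine Real.sInf_nonneg fun a ha => ?_
  obtain ⟨f, -, rfl⟩ := Finset.mem_image.mp (Finset.mem_coe.mp ha)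
  exact hκ f

/-- Non-emptiness of the Flower-polytope: the sparsified vector `z`
obtained from a feasible point `(x,y)` of the LP relaxation is feasible for the
Flower-polytope. -/
theorem flower_polytope_feasible {X : Type*} [MetricSpace X] [Fintype X]
    (C F : Finset X) (hdisj : Disjoint C F) (hcover : C ∪ F = Finset.univ)
    (r : ℝ) (hr : 0 ≤ r) (γ : ℕ) (hγ : 1 ≤ γ)
    (κ : X → ℝ) (hκ : ∀ f, 0 ≤ κ f) (K : ℝ)
    (w : Fin γ → X → ℝ) (hw : ∀ ℓ x, 0 ≤ w ℓ x)
    (m : Fin γ → ℝ) (hm : ∀ ℓ, 0 ≤ m ℓ)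
    (x y : X → ℝ)
    (hx : ∀ c ∈ C, 0 ≤ x c ∧ x c ≤ 1) (hy : ∀ f ∈ F, 0 ≤ y f ∧ y f ≤ 1)
    (hbudget : ∑ f ∈ F, κ f * y f ≤ K)
    (hxy : ∀ c ∈ C, x c ≤ ∑ f ∈ ballIn F {c} r, y f)
    (hcov : ∀ ℓ, m ℓ ≤ ∑ c ∈ C, w ℓ c * x c)
    (Q : Finset X) (hQC : Q ⊆ C)
    (hQne : ∀ c ∈ Q, (ballIn F {c} r).Nonempty)
    (hQdisj : ∀ c ∈ Q, ∀ c' ∈ Q, c ≠ c' →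
      Disjoint (ballIn F {c} r) (ballIn F {c'} r))
    (D : X → Finset X) (hDC : ∀ c ∈ Q, D c ⊆ C)
    (hDdisj : ∀ c ∈ Q, ∀ c' ∈ Q, c ≠ c' → Disjoint (D c) (D c'))
    (hDsupp : ∀ b ∈ C, 0 < x b → ∃ c ∈ Q, b ∈ D c)
    (z : X → ℝ) (hz : ∀ c ∈ Q, 0 ≤ z c ∧ z c ≤ 1)
    (hzx : ∀ c ∈ Q, ∀ b ∈ D c, x b ≤ z c)
    (hzy : ∀ c ∈ Q, z c ≤ ∑ f ∈ ballIn F {c} r, y f) :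
    (∀ ℓ, m ℓ ≤ ∑ c ∈ Q, (∑ b ∈ D c, w ℓ b) * z c) ∧
      ∑ c ∈ Q, cheapestNearby F κ r c * z c ≤ K := by
  constructor
  · intro ℓ
    have hsub : Q.biUnion D ⊆ C := Finset.biUnion_subset.mpr hDC
    calc m ℓ ≤ ∑ c ∈ C, w ℓ c * x c := hcov ℓ
      _ = ∑ b ∈ Q.biUnion D, w ℓ b * x b := by
        refine (Finset.sum_subset hsub fun b hb hbD => ?_).symm
        have hxb : x b = 0 := by
          refine le_antisymm (not_lt.mp fun hpos => hbD ?_) (hx b hb).1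
          exact Finset.mem_biUnion.mpr (hDsupp b hb hpos)
        rw [hxb, mul_zero]
      _ = ∑ c ∈ Q, ∑ b ∈ D c, w ℓ b * x b :=
        Finset.sum_biUnion fun c hc c' hc' hne => hDdisj c hc c' hc' hne
      _ ≤ ∑ c ∈ Q, (∑ b ∈ D c, w ℓ b) * z c := by
        refine Finset.sum_le_sum fun c hc => ?_
        rw [Finset.sum_mul]
        exact Finset.sum_le_sum fun b hb =>
          mul_le_mul_of_nonneg_left (hzx c hc b hb) (hw ℓ b)
  · have hsub : (Q.biUnion fun c => ballIn F {c} r) ⊆ F :=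
      Finset.biUnion_subset.mpr fun c _ f hf => mem_of_mem_ballIn hf
    calc ∑ c ∈ Q, cheapestNearby F κ r c * z c
        ≤ ∑ c ∈ Q, ∑ f ∈ ballIn F {c} r, κ f * y f := by
          refine Finset.sum_le_sum fun c hc => ?_
          refine (mul_le_mul_of_nonneg_left (hzy c hc)
            (cheapestNearby_nonneg F hκ r c)).trans ?_
          rw [Finset.mul_sum]
          exact Finset.sum_le_sum fun f hf =>
            mul_le_mul_of_nonneg_right (cheapestNearby_le κ hf)
              (hy f (mem_of_mem_ballIn hf)).1
      _ = ∑ f ∈ Q.biUnion fun c => ballIn F {c} r, κ f * y f :=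
        (Finset.sum_biUnion fun c hc c' hc' hne => hQdisj c hc c' hc' hne).symm
      _ ≤ ∑ f ∈ F, κ f * y f :=
        Finset.sum_le_sum_of_subset_of_nonneg hsub fun f hf _ =>
          mul_nonneg (hκ f) (hy f hf).1
      _ ≤ K := hbudget
end

section
/- Let 𝒰 be a finite set, ℋ ⊆ 2^𝒰 a family of subsets of 𝒰, and M a matroid on ground set ℋ. Then there exists a matroid on ground set 𝒰 (the Rado matroid induced by (𝒰, ℋ, M)) whose independent sets are exactly the sets T ⊆ 𝒰 for which there exists an injection ψ : T → ℋ with t ∈ ψ(t) for all t ∈ T and {ψ(t) : t ∈ T} independent in M; equivalently, the independent sets are exactly the systems of representatives of independent sets of M. -/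
open Finset

attribute [local instance] Classical.propDecidable

/-- `T` can be matched injectively, along the relation `R`, onto an independent set of `M`. -/
def IsIndepMatchable {α β : Type*} (R : α → β → Prop) (M : Matroid β) (T : Set α) : Prop :=
  ∃ ψ : α → β, Set.InjOn ψ T ∧ (∀ t ∈ T, R t (ψ t)) ∧ M.Indep (ψ '' T)

theorem IsIndepMatchable.subset {α β : Type*} {R : α → β → Prop} {M : Matroid β} {S T : Set α}
    (hT : IsIndepMatchable R M T) (hST : S ⊆ T) : IsIndepMatchable R M S := by
  obtain ⟨ψ, hinj, hR, hψ⟩ := hT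
  exact ⟨ψ, hinj.mono hST, fun t ht ↦ hR t (hST ht), hψ.subset (Set.image_mono hST)⟩

theorem IsIndepMatchable.augment {α β : Type*} [Finite α] {R : α → β → Prop} {M : Matroid β}
    {I J : Set α} (hI : IsIndepMatchable R M I) (hJ : IsIndepMatchable R M J)
    (hIJ : I.ncard < J.ncard) : ∃ e ∈ J, e ∉ I ∧ IsIndepMatchable R M (insert e I) := by
  obtain ⟨φ, hφinj, hφR, hφ⟩ := hJ
  obtain ⟨ψ, hψ⟩ := hI
  induction hn : {t ∈ I | ψ t ≠ φ t}.ncard using Nat.strong_induction_on generalizing ψ with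
  | _ n ih =>
  obtain ⟨hψinj, hψR, hψ⟩ := hψ
  have hcard : (ψ '' I).encard < (φ '' J).encard := by
    rw [hψinj.encard_image, hφinj.encard_image, ← (Set.toFinite I).cast_ncard_eq,
      ← (Set.toFinite J).cast_ncard_eq]
    exact_mod_cast hIJ
  obtain ⟨_, ⟨⟨j, hj, rfl⟩, hjψ⟩, hins⟩ := hψ.augment hφ hcard
  have hoff : ∀ t, t ≠ j → Function.update ψ j (φ j) t = ψ t :=
    fun t ht ↦ Function.update_of_ne ht _ _
  have hinj : Set.InjOn (Function.update ψ j (φ j)) (insert j I) := by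
    intro s hs t ht hst
    by_cases hsj : s = j <;> by_cases htj : t = j
    · rw [hsj, htj]
    · subst hsj
      rw [Function.update_self, hoff t htj] at hst
      exact (hjψ ⟨t, ht.resolve_left htj, hst.symm⟩).elim
    · subst htj
      rw [Function.update_self, hoff s hsj] at hst
      exact (hjψ ⟨s, hs.resolve_left hsj, hst⟩).elim
    · rw [hoff s hsj, hoff t htj] at hst
      exact hψinj (hs.resolve_left hsj) (ht.resolve_left htj) hst
  have hR : ∀ t ∈ insert j I, R t (Function.update ψ j (φ j) t) := by
    intro t ht
    by_cases htj : t = j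
    · subst htj
      rw [Function.update_self]
      exact hφR t hj
    · rw [hoff t htj]
      exact hψR t (ht.resolve_left htj)
  have hind : M.Indep (Function.update ψ j (φ j) '' insert j I) := by
    refine hins.subset ?_
    rintro _ ⟨t, ht, rfl⟩
    by_cases htj : t = j
    · subst htj
      rw [Function.update_self]
      exact Set.mem_insert _ _
    · rw [hoff t htj]
      exact Set.mem_insert_of_mem _ ⟨t, ht.resolve_left htj, rfl⟩
  by_cases hjI : j ∈ I
  · rw [Set.insert_eq_of_mem hjI] at hinj hR hind
    refine ih _ ?_ _ ⟨hinj, hR, hind⟩ rfl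
    rw [← hn]
    refine Set.ncard_lt_ncard ⟨?_, fun hsub ↦ ?_⟩ (Set.toFinite _)
    · rintro t ⟨ht, hne⟩
      by_cases htj : t = j
      · subst htj
        exact (hne (Function.update_self ..)).elim
      · exact ⟨ht, by rwa [hoff t htj] at hne⟩
    · exact (hsub ⟨hjI, fun h ↦ hjψ ⟨j, hjI, h⟩⟩).2 (Function.update_self ..)
  · exact ⟨j, hj, hjI, _, hinj, hR, hind⟩

/-- Rado matroid: for a finite universe `𝒰`, a family `ℋ ⊆ 2^𝒰` and a
matroid `M` on ground set `ℋ`, there is a matroid on `𝒰` whose independent sets are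
exactly the systems of representatives of independent sets of `M`, i.e. the sets
`T ⊆ 𝒰` admitting an injection `ψ : T → ℋ` with `t ∈ ψ(t)` for all `t ∈ T` and
`ψ(T)` independent in `M`. -/
theorem exists_rado_matroid {U : Type*} [Fintype U] [DecidableEq U]
    (ℋ : Finset (Finset U)) (M : Matroid (Finset U)) (hME : M.E = ↑ℋ) :
    ∃ N : Matroid U, N.E = Set.univ ∧
      ∀ T : Set U, N.Indep T ↔
        ∃ ψ : U → Finset U, Set.InjOn ψ T ∧ (∀ t ∈ T, t ∈ ψ t) ∧
          M.Indep (ψ '' T) := by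
  refine ⟨(IndepMatroid.ofFinite (E := Set.univ) Set.finite_univ
    (IsIndepMatchable (fun t H ↦ t ∈ H) M) ?_ (fun _ _ hJ hIJ ↦ hJ.subset hIJ)
    (fun _ _ hI hJ hIJ ↦ hI.augment hJ hIJ) (fun _ _ ↦ Set.subset_univ _)).matroid,
    rfl, fun T ↦ Iff.rfl⟩
  exact ⟨fun _ ↦ ∅, by simp⟩
end
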